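/- The set U = {(x,y) ∈ ℝ² : x² + y² + 1 − 2(xy + x + y) < 0} is contained in the open first quadrant {x > 0, y > 0}, and ∫∫_U (1/(xy)) dx dy = 2π². (Consequently the measure (1/(2π²))·1_U·dx dy/(xy), coming from the invariant two-form η = dx∧dy/(xy), is a probability measure on U.) -/

import Mathlib

open MeasureTheory

/-- U = {(x,y) ∈ ℝ² : x² + y² + 1 − 2(xy + x + y) < 0}. -/
def U : Set (ℝ × ℝ) :=
  {p | p.1 ^ 2 + p.2 ^ 2 + 1 - 2 * (p.1 * p.2 + p.1 + p.2) < 0}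

/-- The open triangle of pairs of angles. -/
def Tri : Set (ℝ × ℝ) :=
  regionBetween (fun _ => 0) (fun a => Real.pi - a) (Set.Ioo 0 Real.pi)

/-- Squared side ratios of the triangle with angles a, b, π - a - b. -/
noncomputable def F (p : ℝ × ℝ) : ℝ × ℝ :=
  ((Real.sin p.1 / Real.sin (p.1 + p.2)) ^ 2, (Real.sin p.2 / Real.sin (p.1 + p.2)) ^ 2)

/-- The derivative of F. -/
noncomputable def F' (p : ℝ × ℝ) : ℝ × ℝ →L[ℝ] ℝ × ℝ :=
  (Matrix.toLin (.finTwoProd ℝ) (.finTwoProd ℝ)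
    !![2 * Real.sin p.1 * Real.sin p.2 / Real.sin (p.1 + p.2) ^ 3,
       -(2 * Real.sin p.1 ^ 2 * Real.cos (p.1 + p.2) / Real.sin (p.1 + p.2) ^ 3);
       -(2 * Real.sin p.2 ^ 2 * Real.cos (p.1 + p.2) / Real.sin (p.1 + p.2) ^ 3),
       2 * Real.sin p.1 * Real.sin p.2 / Real.sin (p.1 + p.2) ^ 3]).toContinuousLinearMap

lemma mem_Tri {p : ℝ × ℝ} : p ∈ Tri ↔ 0 < p.1 ∧ 0 < p.2 ∧ p.1 + p.2 < Real.pi := by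
  simp only [Tri, regionBetween, Set.mem_ofPred_eq, Set.mem_Ioo]
  constructor
  · rintro ⟨⟨h1, h2⟩, h3, h4⟩
    exact ⟨h1, h3, by linarith⟩
  · rintro ⟨h1, h2, h3⟩
    exact ⟨⟨h1, by linarith⟩, h2, by linarith⟩

lemma Tri_sin {p : ℝ × ℝ} (h : p ∈ Tri) :
    0 < Real.sin p.1 ∧ 0 < Real.sin p.2 ∧ 0 < Real.sin (p.1 + p.2) := by
  obtain ⟨h1, h2, h3⟩ := mem_Tri.1 h
  exact ⟨Real.sin_pos_of_pos_of_lt_pi h1 (by linarith),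
    Real.sin_pos_of_pos_of_lt_pi h2 (by linarith),
    Real.sin_pos_of_pos_of_lt_pi (by linarith) h3⟩

lemma hasF {p : ℝ × ℝ} (h : p ∈ Tri) : HasFDerivAt F (F' p) p := by
  obtain ⟨h1, h2, h3⟩ := Tri_sin h
  have h0 : HasFDerivAt (fun q : ℝ × ℝ => q.1 + q.2)
      (ContinuousLinearMap.fst ℝ ℝ ℝ + ContinuousLinearMap.snd ℝ ℝ ℝ) p :=
    hasFDerivAt_fst.add hasFDerivAt_snd
  have h0' : HasFDerivAt (fun q : ℝ × ℝ => Real.sin (q.1 + q.2)) _ p :=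
    HasDerivAt.comp_hasFDerivAt (f := fun q : ℝ × ℝ => q.1 + q.2) p
      (Real.hasDerivAt_sin (p.1 + p.2)) h0
  have hs : HasFDerivAt (fun q : ℝ × ℝ => (Real.sin (q.1 + q.2))⁻¹) _ p :=
    HasDerivAt.comp_hasFDerivAt (f := fun q : ℝ × ℝ => Real.sin (q.1 + q.2)) p
      (hasDerivAt_inv h3.ne') h0'
  have ha := (((Real.hasDerivAt_sin p.1).comp_hasFDerivAt p hasFDerivAt_fst).mul hs).pow 2
  have hb := (((Real.hasDerivAt_sin p.2).comp_hasFDerivAt p hasFDerivAt_snd).mul hs).pow 2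
  have e1 : Real.sin p.2 = Real.sin (p.1 + p.2) * Real.cos p.1
      - Real.cos (p.1 + p.2) * Real.sin p.1 := by
    rw [← Real.sin_sub]; congr 1; ring
  have e2 : Real.sin p.1 = Real.sin (p.1 + p.2) * Real.cos p.2
      - Real.cos (p.1 + p.2) * Real.sin p.2 := by
    rw [← Real.sin_sub]; congr 1; ring
  have := HasFDerivAt.prodMk (𝕜 := ℝ) ha hb
  have hd : HasFDerivAt F _ p := this
  refine hd.congr_fderiv ?_
  unfold F'
  rw [Matrix.toLin_finTwoProd_toContinuousLinearMap]
  ext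
  · simp
    field_simp
    linear_combination -e1
  · simp
    field_simp
  · simp
    field_simp
  · simp
    field_simp
    linear_combination -e2

lemma detF {p : ℝ × ℝ} (h : p ∈ Tri) : |(F' p).det| * (1 / ((F p).1 * (F p).2)) = 4 := by
  obtain ⟨h1, h2, h3⟩ := Tri_sin h
  have hd : (F' p).det = 4 * ((F p).1 * (F p).2) := by
    unfold F'
    rw [LinearMap.det_toContinuousLinearMap, LinearMap.det_toLin, Matrix.det_fin_two_of]
    simp only [F]
    field_simp
    rw [Real.cos_sq']
    ring
  have hp : 0 < (F p).1 * (F p).2 := by simp only [F]; positivity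
  rw [hd, abs_of_pos (by positivity)]
  generalize (F p).1 * (F p).2 = z at *
  field_simp

lemma cosrule (a b : ℝ) : Real.sin b ^ 2 + Real.sin (a + b) ^ 2 - Real.sin a ^ 2
    = 2 * Real.sin b * Real.sin (a + b) * Real.cos a := by
  rw [Real.sin_add]
  have ha := Real.sin_sq_add_cos_sq a
  have hb := Real.sin_sq_add_cos_sq b
  linear_combination (-Real.sin b ^ 2) * ha + Real.sin a ^ 2 * hb

lemma injF : Set.InjOn F Tri := by
  intro p hp q hq h
  obtain ⟨p1, p2, p3⟩ := Tri_sin hp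
  obtain ⟨q1, q2, q3⟩ := Tri_sin hq
  obtain ⟨a1, a2, a3⟩ := mem_Tri.1 hp
  obtain ⟨b1, b2, b3⟩ := mem_Tri.1 hq
  simp only [F, Prod.mk.injEq] at h
  obtain ⟨hx, hy⟩ := h
  rw [sq_eq_sq₀ (by positivity) (by positivity)] at hx hy
  have key : ∀ a b : ℝ, 0 < Real.sin b → 0 < Real.sin (a + b) → Real.cos a =
      ((Real.sin b / Real.sin (a+b)) ^ 2 + 1 - (Real.sin a / Real.sin (a+b)) ^ 2) /
        (2 * (Real.sin b / Real.sin (a+b))) := by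
    intro a b hb hs
    have := cosrule a b
    field_simp
    linarith
  have k1 := key _ _ p2 p3
  have k2 := key _ _ q2 q3
  have k3 := key p.2 p.1 p1 (by rwa [add_comm])
  have k4 := key q.2 q.1 q1 (by rwa [add_comm])
  rw [add_comm p.2] at k3
  rw [add_comm q.2] at k4
  rw [hx, hy, ← k2] at k1
  rw [hx, hy, ← k4] at k3
  exact Prod.ext (Real.injOn_cos ⟨a1.le, by linarith⟩ ⟨b1.le, by linarith⟩ k1)
    (Real.injOn_cos ⟨a2.le, by linarith⟩ ⟨b2.le, by linarith⟩ k3)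

lemma U_pos : ∀ p ∈ U, 0 < p.1 ∧ 0 < p.2 := by
  intro p hp
  simp only [U, Set.mem_ofPred_eq] at hp
  constructor
  · nlinarith [sq_nonneg (p.2 - p.1 - 1)]
  · nlinarith [sq_nonneg (p.1 - p.2 - 1)]

lemma imF : F '' Tri = U := by
  apply Set.Subset.antisymm
  · rintro _ ⟨p, hp, rfl⟩
    obtain ⟨p1, p2, p3⟩ := Tri_sin hp
    obtain ⟨a1, a2, a3⟩ := mem_Tri.1 hp
    have hc := cosrule p.1 p.2
    have hsc := Real.sin_sq_add_cos_sq p.1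
    simp only [U, Set.mem_ofPred_eq, F]
    generalize Real.sin (p.1 + p.2) = s at *
    have : ((Real.sin p.1 / s) ^ 2) ^ 2 + ((Real.sin p.2 / s) ^ 2) ^ 2 + 1
        - 2 * ((Real.sin p.1 / s) ^ 2 * (Real.sin p.2 / s) ^ 2 + (Real.sin p.1 / s) ^ 2
          + (Real.sin p.2 / s) ^ 2) = - (2 * Real.sin p.2 * Real.sin p.1) ^ 2 / s ^ 2 := by
      field_simp
      linear_combination (Real.sin p.2 ^ 2 + s ^ 2 - Real.sin p.1 ^ 2
        + 2 * Real.sin p.2 * s * Real.cos p.1) * hc + 4 * Real.sin p.2 ^ 2 * s ^ 2 * hsc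
    rw [this, neg_div]
    have : 0 < (2 * Real.sin p.2 * Real.sin p.1) ^ 2 / s ^ 2 := by positivity
    linarith
  · rintro ⟨x, y⟩ hp
    obtain ⟨hx, hy⟩ := U_pos _ hp
    simp only [U, Set.mem_ofPred_eq] at hp hx hy
    obtain ⟨u, hu, rfl⟩ : ∃ u, 0 < u ∧ u ^ 2 = x := ⟨√x, by positivity, Real.sq_sqrt hx.le⟩
    obtain ⟨v, hv, rfl⟩ : ∃ v, 0 < v ∧ v ^ 2 = y := ⟨√y, by positivity, Real.sq_sqrt hy.le⟩
    obtain ⟨d, hd, hde⟩ : ∃ d, 0 < d ∧ d ^ 2 = -((u^2) ^ 2 + (v^2) ^ 2 + 1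
        - 2 * (u^2 * v^2 + u^2 + v^2)) :=
      ⟨√(-((u^2) ^ 2 + (v^2) ^ 2 + 1 - 2 * (u^2 * v^2 + u^2 + v^2))),
        Real.sqrt_pos.2 (by linarith), Real.sq_sqrt (by linarith)⟩
    have key : ∀ c e : ℝ, 0 < e → c ^ 2 + e ^ 2 = 1 → 0 < Real.arccos c ∧
        Real.arccos c < Real.pi ∧ Real.cos (Real.arccos c) = c ∧ Real.sin (Real.arccos c) = e := by
      intro c e he h
      have h1 : -1 < c := by nlinarith
      have h2 : c < 1 := by nlinarith
      refine ⟨Real.arccos_pos.2 h2, ?_, Real.cos_arccos h1.le h2.le, ?_⟩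
      · refine lt_of_le_of_ne (Real.arccos_le_pi c) ?_
        intro h
        exact absurd (Real.arccos_eq_pi.1 h) (by linarith)
      · rw [Real.sin_arccos, show 1 - c ^ 2 = e ^ 2 by linarith, Real.sqrt_sq he.le]
    obtain ⟨a1, a2, a3, a4⟩ := key ((v ^ 2 + 1 - u ^ 2) / (2 * v)) (d / (2 * v)) (by positivity)
      (by field_simp; linear_combination hde)
    obtain ⟨b1, b2, b3, b4⟩ := key ((u ^ 2 + 1 - v ^ 2) / (2 * u)) (d / (2 * u)) (by positivity)
      (by field_simp; linear_combination hde)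
    generalize Real.arccos ((v ^ 2 + 1 - u ^ 2) / (2 * v)) = a at *
    generalize Real.arccos ((u ^ 2 + 1 - v ^ 2) / (2 * u)) = b at *
    have hs : Real.sin (a + b) = d / (2 * u * v) := by
      rw [Real.sin_add, a3, a4, b3, b4]
      field_simp
      ring
    refine ⟨(a, b), mem_Tri.2 ⟨a1, b1, ?_⟩, ?_⟩
    · by_contra! hcon
      simp only at hcon
      have h0 : 0 ≤ Real.sin (a + b - Real.pi) :=
        Real.sin_nonneg_of_nonneg_of_le_pi (by linarith) (by linarith)
      rw [Real.sin_sub_pi, hs] at h0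
      have : 0 < d / (2 * u * v) := by positivity
      linarith
    · simp only [F, hs, a4, b4, Prod.mk.injEq]
      constructor <;> field_simp

lemma measTri : MeasurableSet Tri :=
  measurableSet_regionBetween measurable_const (by fun_prop) measurableSet_Ioo

lemma volTri : volume.real Tri = Real.pi ^ 2 / 2 := by
  have hi : ∫ y in Set.Ioo 0 Real.pi, ((fun a : ℝ => Real.pi - a) - (fun _ : ℝ => (0:ℝ))) y
      = Real.pi ^ 2 / 2 := by
    rw [← integral_Ioc_eq_integral_Ioo, ← intervalIntegral.integral_of_le Real.pi_pos.le]
    simp only [Pi.sub_apply, sub_zero]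
    rw [intervalIntegral.integral_sub (by simp) (by simp)]
    simp
    ring
  have := volume_regionBetween_eq_integral (μ := volume) (f := fun _ => (0:ℝ))
    (g := fun a => Real.pi - a) (s := Set.Ioo 0 Real.pi)
    ((continuous_const.integrableOn_Icc).mono_set Set.Ioo_subset_Icc_self)
    (((by fun_prop : Continuous fun a : ℝ => Real.pi - a).integrableOn_Icc).mono_set
      Set.Ioo_subset_Icc_self) measurableSet_Ioo (fun x hx => by linarith [hx.2])
  rw [hi] at this
  rw [Measure.real, Tri, Measure.volume_eq_prod, this, ENNReal.toReal_ofReal (by positivity)]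

/-- U lies in the open first quadrant and ∫∫_U dx dy/(xy) = 2π². -/
theorem stmt_13 :
    (∀ p ∈ U, 0 < p.1 ∧ 0 < p.2) ∧
    (∫ p in U, 1 / (p.1 * p.2)) = 2 * Real.pi ^ 2 := by
  refine ⟨U_pos, ?_⟩
  rw [← imF, integral_image_eq_integral_abs_det_fderiv_smul volume measTri
    (fun p hp => (hasF hp).hasFDerivWithinAt) injF]
  rw [setIntegral_congr_fun (g := fun _ => (4:ℝ)) measTri (fun p hp => by
    simpa only [smul_eq_mul] using detF hp)]
  rw [setIntegral_const, volTri, smul_eq_mul]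
  ring
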